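/- For p + q + l ≤ n, the multiplication map by g^l from D^{p,q} to D^{p+l,q+l} is injective. -/

import Mathlib

open scoped BigOperators

namespace DoubleForm

/-- The model Euclidean vector space of dimension `n` (with the standard inner product). -/
abbrev V (n : ℕ) := Fin n → ℝ

/-- The standard orthonormal basis of `V n`. -/
def E (n : ℕ) (j : Fin n) : V n := fun k => if k = j then 1 else 0

/-- Raw double forms of bidegree `(p,q)`: real valued functions of `p` vectors and `q` vectors.
Genuine double forms are singled out by `IsDF`. -/
abbrev DF (n p q : ℕ) := (Fin p → V n) → (Fin q → V n) → ℝ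

/-- `ω` is a genuine double form: multilinear and alternating in the first `p`
and in the last `q` arguments. -/
def IsDF {n p q : ℕ} (ω : DF n p q) : Prop :=
  ∃ F : AlternatingMap ℝ (V n) (AlternatingMap ℝ (V n) ℝ (Fin q)) (Fin p),
    ∀ x y, ω x y = F x y

/-- Transport of double forms along equalities of the degrees. -/
def DFcast {n p q p' q' : ℕ} (h1 : p = p') (h2 : q = q') (ω : DF n p q) : DF n p' q' :=
  fun x y => ω (fun i => x (Fin.cast h1 i)) (fun j => y (Fin.cast h2 j))

/-- The product of double forms (Kulkarni's product). -/
noncomputable def mul {n p q r s : ℕ} (ω : DF n p q) (η : DF n r s) :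
    DF n (p + r) (q + s) := fun x y =>
  (((p.factorial * r.factorial * q.factorial * s.factorial : ℕ) : ℝ))⁻¹ *
    ∑ σ : Equiv.Perm (Fin (p + r)), ∑ ρ : Equiv.Perm (Fin (q + s)),
      ((Equiv.Perm.sign σ : ℤ) : ℝ) * ((Equiv.Perm.sign ρ : ℤ) : ℝ) *
        ω (fun i => x (σ (Fin.castAdd r i))) (fun j => y (ρ (Fin.castAdd s j))) *
        η (fun i => x (σ (Fin.natAdd p i))) (fun j => y (ρ (Fin.natAdd q j)))

/-- The metric `g` as a double form of bidegree `(1,1)`. -/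
noncomputable def gm (n : ℕ) : DF n 1 1 := fun x y => ∑ j : Fin n, x 0 j * y 0 j

/-- Powers `g^l` of the metric in the algebra of double forms. -/
noncomputable def gpow (n : ℕ) : (l : ℕ) → DF n l l
  | 0 => fun _ _ => 1
  | l + 1 => mul (gpow n l) (gm n)

/-- The contraction map `c : D^{p,q} → D^{p-1,q-1}` (zero if `p = 0` or `q = 0`). -/
noncomputable def contr {n : ℕ} : ∀ {p q : ℕ}, DF n p q → DF n (p - 1) (q - 1)
  | p + 1, q + 1, ω => fun x y =>
      ∑ j : Fin n, ω (Fin.cons (E n j) x) (Fin.cons (E n j) y)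
  | 0, _, _ => 0
  | _ + 1, 0, _ => 0

/-- Iterated contraction `c^k`. -/
noncomputable def ck {n : ℕ} : ∀ (k : ℕ) {p q : ℕ}, DF n p q → DF n (p - k) (q - k)
  | 0, _, _, ω => ω
  | k + 1, _, _, ω => contr (ck k ω)

/-- The natural inner product on `D^{p,q}`. -/
noncomputable def innerDF {n p q : ℕ} (ω θ : DF n p q) : ℝ :=
  (((p.factorial * q.factorial : ℕ) : ℝ))⁻¹ *
    ∑ f : Fin p → Fin n, ∑ g : Fin q → Fin n,
      ω (fun i => E n (f i)) (fun j => E n (g j)) *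
        θ (fun i => E n (f i)) (fun j => E n (g j))

/-- The natural inner product extended to all bidegrees: distinct bidegrees are orthogonal. -/
noncomputable def innerDF2 {n p q r s : ℕ} (ω : DF n p q) (θ : DF n r s) : ℝ :=
  if h : p = r ∧ q = s then innerDF (DFcast h.1 h.2 ω) θ else 0

/-- Determinant of the `n × n` matrix whose first `p` rows are the basis vectors `E (f i)`
and whose remaining rows are the vectors `x`. -/
noncomputable def rowsDet {n : ℕ} (p : ℕ) (f : Fin p → Fin n) (x : Fin (n - p) → V n) : ℝ :=
  Matrix.det (Matrix.of fun i k : Fin n =>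
    if h : (i : ℕ) < p then E n (f ⟨(i : ℕ), h⟩) k
    else x ⟨(i : ℕ) - p, by have := i.isLt; omega⟩ k)

/-- The Hodge star operator extended to double forms, `D^{p,q} → D^{n-p,n-q}`. -/
noncomputable def hstar {n p q : ℕ} (ω : DF n p q) : DF n (n - p) (n - q) := fun x y =>
  (((p.factorial * q.factorial : ℕ) : ℝ))⁻¹ *
    ∑ f : Fin p → Fin n, ∑ g : Fin q → Fin n,
      ω (fun i => E n (f i)) (fun j => E n (g j)) * rowsDet p f x * rowsDet q g y

/-- The first Bianchi sum `B : D^{p,q} → D^{p+1,q-1}` (zero if `q = 0`). -/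
noncomputable def bianchi {n : ℕ} : ∀ {p q : ℕ}, DF n p q → DF n (p + 1) (q - 1)
  | p, q + 1, ω => fun x y =>
      ∑ j : Fin (p + 1), (-1 : ℝ) ^ ((j : ℕ) + 1) *
        ω (fun i => x (j.succAbove i)) (Fin.cons (x j) y)
  | _, 0, _ => 0

/-- Symmetric double forms of bidegree `(p,p)`. -/
def IsSymm {n p : ℕ} (ω : DF n p p) : Prop := ∀ x y, ω x y = ω y x

/-- The total (bigraded) space of double forms. -/
abbrev DT (n : ℕ) := ∀ p q : ℕ, DF n p q

/-- Embedding of the component `D^{p,q}` into the total space. -/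
noncomputable def emb {n : ℕ} (p q : ℕ) (ω : DF n p q) : DT n := fun p' q' =>
  if h : p = p' ∧ q = q' then DFcast h.1 h.2 ω else 0


/-- Double forms of bidegree `(p, q)`, bundled as alternating maps. -/
abbrev AltForm (n p q : ℕ) := V n [⋀^Fin p]→ₗ[ℝ] (V n [⋀^Fin q]→ₗ[ℝ] ℝ)

/-- The exterior product of `w ↦ v ⬝ᵥ w` with an alternating form. -/
noncomputable def wedgeRight (n q : ℕ) :
    V n →ₗ[ℝ] (V n [⋀^Fin q]→ₗ[ℝ] ℝ) →ₗ[ℝ] (V n [⋀^Fin (q + 1)]→ₗ[ℝ] ℝ) :=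
  LinearMap.mk₂ ℝ
    (fun v η => AlternatingMap.alternatizeUncurryFin ((dotProductBilin ℝ ℝ v).smulRight η))
    (fun v w η => by
      ext y; simp [AlternatingMap.alternatizeUncurryFin_apply, add_mul,
        Finset.sum_add_distrib])
    (fun c v η => by
      ext y; simp [AlternatingMap.alternatizeUncurryFin_apply, Finset.mul_sum, mul_assoc,
        mul_left_comm])
    (fun v η θ => by
      ext y; simp [AlternatingMap.alternatizeUncurryFin_apply, Finset.sum_add_distrib])
    (fun c v η => by
      ext y; simp [AlternatingMap.alternatizeUncurryFin_apply, Finset.mul_sum, mul_left_comm])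

theorem wedgeRight_apply {n q : ℕ} (v : V n) (η : V n [⋀^Fin q]→ₗ[ℝ] ℝ) (y : Fin (q + 1) → V n) :
    wedgeRight n q v η y =
      ∑ j : Fin (q + 1), (-1) ^ (j : ℕ) * ((v ⬝ᵥ y j) * η (y ∘ j.succAbove)) := by
  simp [wedgeRight, AlternatingMap.alternatizeUncurryFin_apply]
  rfl

theorem alternatingMap_sum_apply {M N ι α : Type*} [AddCommGroup M] [Module ℝ M]
    [AddCommGroup N] [Module ℝ N] (s : Finset α) (f : α → M [⋀^ι]→ₗ[ℝ] N) (x : ι → M) :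
    (∑ a ∈ s, f a) x = ∑ a ∈ s, f a x :=
  map_sum (⟨⟨fun g => g x, rfl⟩, fun _ _ => rfl⟩ : (M [⋀^ι]→ₗ[ℝ] N) →+ N) f s

/-- Multiplication by the metric. -/
noncomputable def metricMul (n p q : ℕ) : AltForm n p q →ₗ[ℝ] AltForm n (p + 1) (q + 1) :=
  AlternatingMap.alternatizeUncurryFinLM ∘ₗ
    { toFun F :=
        { toFun v := (wedgeRight n q v).compAlternatingMap F
          map_add' v w := by ext; simp
          map_smul' c v := by ext; simp }
      map_add' F G := by ext; simp
      map_smul' c F := by ext; simp }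

theorem metricMul_apply {n p q : ℕ} (F : AltForm n p q)
    (x : Fin (p + 1) → V n) (y : Fin (q + 1) → V n) :
    metricMul n p q F x y = ∑ i : Fin (p + 1), ∑ j : Fin (q + 1),
      (-1) ^ (i : ℕ) * (-1) ^ (j : ℕ) * (x i ⬝ᵥ y j) *
        F (x ∘ i.succAbove) (y ∘ j.succAbove) := by
  have h (i : Fin (p + 1)) : ((-1 : ℤ) ^ (i : ℕ) • wedgeRight n q (x i) (F (i.removeNth x))) y =
      ∑ j : Fin (q + 1), (-1) ^ (i : ℕ) * (-1) ^ (j : ℕ) * (x i ⬝ᵥ y j) *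
        F (x ∘ i.succAbove) (y ∘ j.succAbove) := by
    simp [wedgeRight_apply, Finset.mul_sum, mul_assoc]
    rfl
  simp [metricMul, AlternatingMap.alternatizeUncurryFin_apply, alternatingMap_sum_apply, ← h]

/-- The contraction of bundled double forms. -/
noncomputable def contraction (n p q : ℕ) : AltForm n (p + 1) (q + 1) →ₗ[ℝ] AltForm n p q :=
  ∑ e : Fin n, (AlternatingMap.curryLeftLinearMap.flip (E n e)).compAlternatingMapₗ ℝ ∘ₗ
    AlternatingMap.curryLeftLinearMap.flip (E n e)

theorem contraction_apply {n p q : ℕ} (F : AltForm n (p + 1) (q + 1))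
    (x : Fin p → V n) (y : Fin q → V n) :
    contraction n p q F x y =
      ∑ e, F (Matrix.vecCons (E n e) x) (Matrix.vecCons (E n e) y) := by
  simp [contraction, alternatingMap_sum_apply]

theorem E_eq_single {n : ℕ} (e : Fin n) : E n e = Pi.single e 1 := by
  ext k; simp [E, Pi.single_apply]

theorem vecCons_comp_succAbove_zero {M : Type*} {p : ℕ} (v : M) (x : Fin p → M) :
    Matrix.vecCons v x ∘ Fin.succAbove 0 = x := by
  funext k; simp

theorem vecCons_comp_succAbove_succ {M : Type*} {p : ℕ} (v : M) (x : Fin (p + 1) → M)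
    (i : Fin (p + 1)) :
    Matrix.vecCons v x ∘ i.succ.succAbove = Matrix.vecCons v (x ∘ i.succAbove) := by
  funext k; cases k using Fin.cases <;> simp

theorem sum_smul_map_vecCons {n p : ℕ} {N : Type*} [AddCommGroup N] [Module ℝ N]
    (G : V n [⋀^Fin p]→ₗ[ℝ] N) (x : Fin p → V n) (i : Fin p) :
    ∑ e, x i e • G (Matrix.vecCons (E n e) x ∘ i.succ.succAbove) = (-1 : ℝ) ^ (i : ℕ) • G x := by
  obtain _ | p := p
  · exact i.elim0
  have hx : ∑ e, x i e • E n e = x i := by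
    simp only [E_eq_single]
    exact (pi_eq_sum_univ' _).symm
  calc _ = G.curryLeft (∑ e, x i e • E n e) (x ∘ i.succAbove) := by
        simp [vecCons_comp_succAbove_succ, alternatingMap_sum_apply]
    _ = _ := by
        rw [hx, AlternatingMap.curryLeft_apply_apply,
          ← AlternatingMap.neg_one_pow_smul_map_insertNth]
        change _ • G (i.insertNth (x i) (i.removeNth x)) = _
        rw [Fin.insertNth_self_removeNth]
        rcases (i : ℕ).even_or_odd with h | h <;> simp [h.neg_one_pow]

theorem contraction_metricMul {n p q : ℕ} (F : AltForm n p q)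
    (x : Fin p → V n) (y : Fin q → V n) :
    contraction n p q (metricMul n p q F) x y = (n - p - q : ℝ) * F x y +
      ∑ i : Fin p, ∑ j : Fin q, (-1) ^ (i : ℕ) * (-1) ^ (j : ℕ) * (x i ⬝ᵥ y j) *
        ∑ e, F (Matrix.vecCons (E n e) x ∘ i.succ.succAbove)
          (Matrix.vecCons (E n e) y ∘ j.succ.succAbove) := by
  have hy : ∑ e, ∑ j : Fin q, (-1) ^ (j : ℕ) * y j e *
      F x (Matrix.vecCons (E n e) y ∘ j.succ.succAbove) = q * F x y := by
    rw [Finset.sum_comm]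
    have := fun j => sum_smul_map_vecCons (F x) y j
    simp only [smul_eq_mul] at this
    simp [mul_assoc, ← Finset.mul_sum, this]
    simp [← mul_assoc, ← pow_add, ← two_mul]
  have hx : ∑ e, ∑ i : Fin p, (-1) ^ (i : ℕ) * x i e *
      F (Matrix.vecCons (E n e) x ∘ i.succ.succAbove) y = p * F x y := by
    rw [Finset.sum_comm]
    have := fun i => congrArg (fun η => η y) (sum_smul_map_vecCons F x i)
    simp [alternatingMap_sum_apply] at this
    simp [mul_assoc, ← Finset.mul_sum, this]
    simp [← mul_assoc, ← pow_add, ← two_mul]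
  have hE (e : Fin n) (v : V n) : E n e ⬝ᵥ v = v e ∧ v ⬝ᵥ E n e = v e := by
    simp [E_eq_single]
  have hEE (e : Fin n) : E n e e = 1 := by simp [E]
  simp only [contraction_apply, metricMul_apply, Fin.sum_univ_succ, Matrix.cons_val_zero,
    Matrix.cons_val_succ, vecCons_comp_succAbove_zero, hE, hEE, Fin.val_succ, Fin.val_zero,
    pow_succ, pow_zero, Finset.sum_add_distrib, mul_neg, neg_mul, one_mul, mul_one,
    Finset.sum_neg_distrib, hx, hy, Finset.sum_const, Finset.card_univ, Fintype.card_fin,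
    nsmul_eq_mul]
  have hcomm : ∀ f : Fin n → Fin p → Fin q → ℝ,
      ∑ e, ∑ i, ∑ j, f e i j = ∑ i, ∑ j, ∑ e, f e i j := fun f => by
    rw [Finset.sum_comm]
    exact Finset.sum_congr rfl fun i _ => Finset.sum_comm
  rw [hcomm]
  simp only [Finset.mul_sum]
  ring

section SlTwo

variable {M : Type*} [AddCommGroup M] [Module ℝ M] {L C H : Module.End ℝ M} {μ : ℝ} {x : M}

theorem weight_pow_apply (hHL : ∀ x, H (L x) = L (H x) - (2 : ℝ) • L x) (hx : H x = μ • x)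
    (l : ℕ) : H ((L ^ l) x) = (μ - 2 * l) • (L ^ l) x := by
  induction l with
  | zero => simp [hx]
  | succ l ih =>
    rw [pow_succ', Module.End.mul_apply, hHL, ih, map_smul]
    push_cast
    module

theorem lowering_pow_succ_apply (hCL : ∀ x, C (L x) = L (C x) + H x)
    (hHL : ∀ x, H (L x) = L (H x) - (2 : ℝ) • L x) (hx : H x = μ • x) (l : ℕ) :
    C ((L ^ (l + 1)) x) = (L ^ (l + 1)) (C x) + ((l + 1) * (μ - l) : ℝ) • (L ^ l) x := by
  induction l with
  | zero => simp [hCL, hx]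
  | succ l ih =>
    have hpow (k : ℕ) (z : M) : L ((L ^ k) z) = (L ^ (k + 1)) z := by
      rw [pow_succ', Module.End.mul_apply]
    rw [← hpow, hCL, ih, weight_pow_apply hHL hx, map_add, map_smul, hpow, hpow]
    push_cast
    module

/-- In a representation of `sl₂`, a nonzero vector of weight `μ ≥ l` on which `C` acts nilpotently
is not annihilated by `L ^ l`. -/
theorem eq_zero_of_pow_apply_eq_zero (hCL : ∀ x, C (L x) = L (C x) + H x)
    (hHL : ∀ x, H (L x) = L (H x) - (2 : ℝ) • L x)
    (hHC : ∀ x, H (C x) = C (H x) + (2 : ℝ) • C x) (m l : ℕ) (hx : H x = μ • x) (hl : l ≤ μ)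
    (hC : (C ^ m) x = 0) (hL : (L ^ l) x = 0) : x = 0 := by
  induction m generalizing l μ x with
  | zero => simpa using hC
  | succ m ihm =>
    induction l with
    | zero => simpa using hL
    | succ l ihl =>
      push_cast at hl
      have key := lowering_pow_succ_apply hCL hHL hx l
      rw [hL, map_zero] at key
      have hCx : C x = 0 := by
        refine ihm (μ := μ + 2) (l + 2) ?_ ?_ ?_ ?_
        · rw [hHC, hx, map_smul, add_smul]
        · push_cast; linarith
        · rwa [pow_succ, Module.End.mul_apply] at hC
        · have := congrArg L key
          rwa [map_zero, map_add, map_smul, ← Module.End.mul_apply, ← pow_succ',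
            ← Module.End.mul_apply L (L ^ l), ← pow_succ', hL, smul_zero, add_zero,
            eq_comm] at this
      rw [hCx, map_zero, zero_add, eq_comm, smul_eq_zero] at key
      refine ihl (by linarith) (key.resolve_left ?_)
      have : 0 < μ - l := by linarith
      positivity

end SlTwo

/-- The total space of bundled double forms. -/
abbrev AltTotal (n : ℕ) := ∀ p q : ℕ, AltForm n p q

/-- Multiplication by the metric on the total space. -/
noncomputable def metricMulTotal (n : ℕ) : Module.End ℝ (AltTotal n) where
  toFun ω := fun
    | p + 1, q + 1 => metricMul n p q (ω p q)
    | 0, _ => 0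
    | _ + 1, 0 => 0
  map_add' ω η := by
    funext p q
    rcases p with _ | p <;> rcases q with _ | q <;> simp
  map_smul' c ω := by
    funext p q
    rcases p with _ | p <;> rcases q with _ | q <;> simp

/-- The contraction on the total space. -/
noncomputable def contractionTotal (n : ℕ) : Module.End ℝ (AltTotal n) where
  toFun ω p q := contraction n p q (ω (p + 1) (q + 1))
  map_add' ω η := by funext p q; simp
  map_smul' c ω := by funext p q; simp

/-- The operator acting on `D^{p,q}` as multiplication by `n - p - q`. -/
noncomputable def weightTotal (n : ℕ) : Module.End ℝ (AltTotal n) where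
  toFun ω p q := (n - p - q : ℝ) • ω p q
  map_add' ω η := by funext p q; simp
  map_smul' c ω := by funext p q; simp [smul_comm c]

theorem contractionTotal_metricMulTotal {n : ℕ} (ω : AltTotal n) :
    contractionTotal n (metricMulTotal n ω) =
      metricMulTotal n (contractionTotal n ω) + weightTotal n ω := by
  funext p q
  ext x y
  have h : contractionTotal n (metricMulTotal n ω) p q =
    contraction n p q (metricMul n p q (ω p q)) := rfl
  rw [h, contraction_metricMul, add_comm]
  rcases p with _ | p
  · simp [metricMulTotal, weightTotal]
  rcases q with _ | q
  · simp [metricMulTotal, weightTotal]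
  simp only [metricMulTotal, contractionTotal, weightTotal, LinearMap.coe_mk, AddHom.coe_mk,
    Pi.add_apply, AlternatingMap.add_apply, AlternatingMap.smul_apply, metricMul_apply,
    contraction_apply, vecCons_comp_succAbove_succ, smul_eq_mul]

theorem weightTotal_metricMulTotal {n : ℕ} (ω : AltTotal n) :
    weightTotal n (metricMulTotal n ω) =
      metricMulTotal n (weightTotal n ω) - (2 : ℝ) • metricMulTotal n ω := by
  funext p q
  ext x y
  rcases p with _ | p <;> rcases q with _ | q <;> simp [metricMulTotal, weightTotal]
  ring

theorem weightTotal_contractionTotal {n : ℕ} (ω : AltTotal n) :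
    weightTotal n (contractionTotal n ω) =
      contractionTotal n (weightTotal n ω) + (2 : ℝ) • contractionTotal n ω := by
  funext p q
  simp [contractionTotal, weightTotal]
  module

theorem contractionTotal_pow_eq_zero {n : ℕ} (m : ℕ) (ω : AltTotal n)
    (h : ∀ p q, m ≤ p → ω p q = 0) : (contractionTotal n ^ m) ω = 0 := by
  induction m generalizing ω with
  | zero => funext p q; simp [h]
  | succ m ih =>
    rw [pow_succ, Module.End.mul_apply]
    refine ih _ fun p q hp => ?_
    simp [contractionTotal, h (p + 1) (q + 1) (by omega)]

/-- The embedding of `D^{p,q}` into the total space. -/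
def single {n p q : ℕ} (F : AltForm n p q) : AltTotal n := Pi.single p (Pi.single q F)

theorem metricMulTotal_single {n p q : ℕ} (F : AltForm n p q) :
    metricMulTotal n (single F) = single (metricMul n p q F) := by
  funext a b
  rcases a with _ | a
  · simp [metricMulTotal, single]
  by_cases ha : a = p
  · subst ha
    rcases b with _ | b
    · simp [metricMulTotal, single]
    by_cases hb : b = q
    · subst hb
      simp [metricMulTotal, single]
    · simp [metricMulTotal, single, hb]
  · rcases b with _ | b <;> simp [metricMulTotal, single, ha]

theorem weightTotal_single {n p q : ℕ} (F : AltForm n p q) :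
    weightTotal n (single F) = (n - p - q : ℝ) • single F := by
  funext a b
  by_cases ha : a = p
  · subst ha
    by_cases hb : b = q
    · subst hb
      simp [weightTotal, single]
    · simp [weightTotal, single, hb]
  · simp [weightTotal, single, ha]

theorem eq_zero_of_metricMulTotal_pow_single {n p q l : ℕ} (h : p + q + l ≤ n) (F : AltForm n p q)
    (hF : (metricMulTotal n ^ l) (single F) = 0) : F = 0 := by
  have h' : ((p + q + l : ℕ) : ℝ) ≤ n := Nat.cast_le.mpr h
  push_cast at h'
  have hC : (contractionTotal n ^ (p + 1)) (single F) = 0 :=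
    contractionTotal_pow_eq_zero _ _ fun a b ha => by simp [single, show a ≠ p by omega]
  have h0 : single F = 0 :=
    eq_zero_of_pow_apply_eq_zero (M := AltTotal n) (L := metricMulTotal n)
      (C := contractionTotal n) (H := weightTotal n) (μ := n - p - q)
      contractionTotal_metricMulTotal weightTotal_metricMulTotal
      weightTotal_contractionTotal (p + 1) l (weightTotal_single F) (by linarith) hC hF
  have h1 := congrFun (congrFun h0 p) q
  rwa [single, Pi.single_eq_same, Pi.single_eq_same] at h1

/-- The double alternation of a double form. -/
noncomputable def altSum (n p q : ℕ) : DF n p q →ₗ[ℝ] DF n p q where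
  toFun Φ x y := ∑ σ : Equiv.Perm (Fin p), ∑ ρ : Equiv.Perm (Fin q),
    ((Equiv.Perm.sign σ : ℤ) : ℝ) * ((Equiv.Perm.sign ρ : ℤ) : ℝ) * Φ (x ∘ σ) (y ∘ ρ)
  map_add' Φ Ψ := by funext x y; simp [mul_add, Finset.sum_add_distrib]
  map_smul' c Φ := by funext x y; simp [Finset.mul_sum, mul_left_comm]

theorem altSum_apply {n p q : ℕ} (Φ : DF n p q) (x : Fin p → V n) (y : Fin q → V n) :
    altSum n p q Φ x y = ∑ σ : Equiv.Perm (Fin p), ∑ ρ : Equiv.Perm (Fin q),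
      ((Equiv.Perm.sign σ : ℤ) : ℝ) * ((Equiv.Perm.sign ρ : ℤ) : ℝ) * Φ (x ∘ σ) (y ∘ ρ) := rfl

/-- Permutation of the arguments of a double form. -/
def permDF {n p q : ℕ} (τ : Equiv.Perm (Fin p)) (π : Equiv.Perm (Fin q)) (Φ : DF n p q) :
    DF n p q := fun x y => Φ (x ∘ τ) (y ∘ π)

theorem sign_mul_self_real {p : ℕ} (τ : Equiv.Perm (Fin p)) :
    ((Equiv.Perm.sign τ : ℤ) : ℝ) * ((Equiv.Perm.sign τ : ℤ) : ℝ) = 1 := by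
  rcases Int.units_eq_one_or (Equiv.Perm.sign τ) with h | h <;> simp [h]

theorem altSum_permDF {n p q : ℕ} (τ : Equiv.Perm (Fin p)) (π : Equiv.Perm (Fin q))
    (Φ : DF n p q) : altSum n p q (permDF τ π Φ) =
      (((Equiv.Perm.sign τ : ℤ) : ℝ) * ((Equiv.Perm.sign π : ℤ) : ℝ)) • altSum n p q Φ := by
  funext x y
  simp only [Pi.smul_apply, altSum_apply, smul_eq_mul, Finset.mul_sum]
  refine Fintype.sum_equiv (Equiv.mulRight τ) _ _ fun σ =>
    Fintype.sum_equiv (Equiv.mulRight π) _ _ fun ρ => ?_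
  simp only [Equiv.coe_mulRight, map_mul, Units.val_mul, Int.cast_mul, Equiv.Perm.coe_mul, permDF,
    Function.comp_assoc]
  linear_combination (-((Equiv.Perm.sign σ : ℤ) : ℝ) * ((Equiv.Perm.sign ρ : ℤ) : ℝ) *
    Φ (x ∘ σ ∘ τ) (y ∘ ρ ∘ π)) * (sign_mul_self_real τ * ((Equiv.Perm.sign π : ℤ) : ℝ) ^ 2 +
      sign_mul_self_real π)

theorem altSum_reindex {n p q p' q' : ℕ} (e : Fin p' ≃ Fin p) (e' : Fin q' ≃ Fin q)
    (Φ : DF n p q) (Ψ : DF n p' q') (h : ∀ x y, Ψ (x ∘ e) (y ∘ e') = Φ x y)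
    (x : Fin p → V n) (y : Fin q → V n) :
    altSum n p' q' Ψ (x ∘ e) (y ∘ e') = altSum n p q Φ x y := by
  simp only [altSum_apply]
  refine Fintype.sum_equiv e.permCongr _ _ fun σ => Fintype.sum_equiv e'.permCongr _ _ fun ρ => ?_
  rw [← h, Equiv.Perm.sign_permCongr, Equiv.Perm.sign_permCongr]
  congr 2 <;> funext i <;> simp

/-- The tensor product of double forms, before alternation. -/
def tensor {n p q r s : ℕ} (ω : DF n p q) (η : DF n r s) : DF n (p + r) (q + s) := fun x y =>
  ω (x ∘ Fin.castAdd r) (y ∘ Fin.castAdd s) * η (x ∘ Fin.natAdd p) (y ∘ Fin.natAdd q)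

theorem mul_eq_smul_altSum {n p q r s : ℕ} (ω : DF n p q) (η : DF n r s) :
    mul ω η = (((p.factorial * r.factorial * q.factorial * s.factorial : ℕ) : ℝ))⁻¹ •
      altSum n (p + r) (q + s) (tensor ω η) := by
  funext x y
  simp only [mul, Pi.smul_apply, altSum_apply, smul_eq_mul, mul_assoc, tensor]
  rfl

theorem mul_eq_zero_iff_altSum {n p q r s : ℕ} (ω : DF n p q) (η : DF n r s) :
    mul ω η = 0 ↔ altSum n (p + r) (q + s) (tensor ω η) = 0 := by
  rw [mul_eq_smul_altSum, smul_eq_zero_iff_right]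
  simp [Nat.factorial_ne_zero]

theorem tensor_permDF_left {n p q r s : ℕ} (τ : Equiv.Perm (Fin p)) (π : Equiv.Perm (Fin q))
    (ω : DF n p q) (η : DF n r s) : tensor (permDF τ π ω) η =
      permDF (finSumFinEquiv.permCongr (Equiv.sumCongr τ 1))
        (finSumFinEquiv.permCongr (Equiv.sumCongr π 1)) (tensor ω η) := by
  funext x y
  simp only [tensor, permDF]
  congr 2 <;> funext i <;> simp [Equiv.permCongr_apply]

theorem tensor_permDF_right {n p q r s : ℕ} (τ : Equiv.Perm (Fin r)) (π : Equiv.Perm (Fin s))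
    (ω : DF n p q) (η : DF n r s) : tensor ω (permDF τ π η) =
      permDF (finSumFinEquiv.permCongr (Equiv.sumCongr 1 τ))
        (finSumFinEquiv.permCongr (Equiv.sumCongr 1 π)) (tensor ω η) := by
  funext x y
  simp only [tensor, permDF]
  congr 2 <;> funext i <;> simp [Equiv.permCongr_apply]

theorem altSum_tensor_permDF_left {n p q r s : ℕ} (τ : Equiv.Perm (Fin p))
    (π : Equiv.Perm (Fin q)) (ω : DF n p q) (η : DF n r s) :
    altSum n (p + r) (q + s) (tensor (permDF τ π ω) η) =
      (((Equiv.Perm.sign τ : ℤ) : ℝ) * ((Equiv.Perm.sign π : ℤ) : ℝ)) •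
        altSum n (p + r) (q + s) (tensor ω η) := by
  rw [tensor_permDF_left, altSum_permDF, Equiv.Perm.sign_permCongr, Equiv.Perm.sign_permCongr]
  simp

theorem altSum_tensor_permDF_right {n p q r s : ℕ} (τ : Equiv.Perm (Fin r))
    (π : Equiv.Perm (Fin s)) (ω : DF n p q) (η : DF n r s) :
    altSum n (p + r) (q + s) (tensor ω (permDF τ π η)) =
      (((Equiv.Perm.sign τ : ℤ) : ℝ) * ((Equiv.Perm.sign π : ℤ) : ℝ)) •
        altSum n (p + r) (q + s) (tensor ω η) := by
  rw [tensor_permDF_right, altSum_permDF, Equiv.Perm.sign_permCongr, Equiv.Perm.sign_permCongr]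
  simp

theorem altSum_tensor_altSum_left {n p q r s : ℕ} (ω : DF n p q) (η : DF n r s) :
    altSum n (p + r) (q + s) (tensor (altSum n p q ω) η) =
      ((p.factorial * q.factorial : ℕ) : ℝ) • altSum n (p + r) (q + s) (tensor ω η) := by
  have h : tensor (altSum n p q ω) η = ∑ τ : Equiv.Perm (Fin p), ∑ π : Equiv.Perm (Fin q),
      (((Equiv.Perm.sign τ : ℤ) : ℝ) * ((Equiv.Perm.sign π : ℤ) : ℝ)) •
        tensor (permDF τ π ω) η := by
    funext x y
    simp [tensor, altSum_apply, Finset.sum_apply, Finset.sum_mul, permDF, mul_assoc]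
  simp only [h, map_sum, map_smul, altSum_tensor_permDF_left, smul_smul]
  simp [mul_mul_mul_comm, sign_mul_self_real, Fintype.card_perm, ← smul_smul,
    ← Nat.cast_smul_eq_nsmul ℝ]

/-- A bundled double form as a raw double form. -/
def toDF {n p q : ℕ} (F : AltForm n p q) : DF n p q := fun x y => F x y

theorem altSum_toDF {n p q : ℕ} (F : AltForm n p q) :
    altSum n p q (toDF F) = ((p.factorial * q.factorial : ℕ) : ℝ) • toDF F := by
  have h (σ : Equiv.Perm (Fin p)) (ρ : Equiv.Perm (Fin q)) (x y) : F (x ∘ σ) (y ∘ ρ) =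
      ((Equiv.Perm.sign σ : ℤ) : ℝ) * ((Equiv.Perm.sign ρ : ℤ) : ℝ) * F x y := by
    rw [AlternatingMap.map_perm, AlternatingMap.map_perm]
    rcases Int.units_eq_one_or (Equiv.Perm.sign σ) with h | h <;>
      rcases Int.units_eq_one_or (Equiv.Perm.sign ρ) with h' | h' <;> simp [h, h']
  have h' (σ : Equiv.Perm (Fin p)) (ρ : Equiv.Perm (Fin q)) (z : ℝ) :
      ((Equiv.Perm.sign σ : ℤ) : ℝ) * ((Equiv.Perm.sign ρ : ℤ) : ℝ) *
        (((Equiv.Perm.sign σ : ℤ) : ℝ) * ((Equiv.Perm.sign ρ : ℤ) : ℝ) * z) = z := by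
    rw [← mul_assoc, mul_mul_mul_comm, sign_mul_self_real, sign_mul_self_real, one_mul, one_mul]
  funext x y
  simp only [altSum_apply, toDF, h, h']
  simp [Fintype.card_perm, mul_assoc, toDF]

/-- The tensor product of the metric with a double form, the metric taking the first arguments. -/
def metricTensor {n p q : ℕ} (Φ : DF n p q) : DF n (p + 1) (q + 1) := fun x y =>
  (x 0 ⬝ᵥ y 0) * Φ (x ∘ Fin.succ) (y ∘ Fin.succ)

theorem toDF_metricMul {n p q : ℕ} (F : AltForm n p q) :
    toDF (metricMul n p q F) = ∑ i : Fin (p + 1), ∑ j : Fin (q + 1),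
      (((-1) ^ (i : ℕ) * (-1) ^ (j : ℕ) : ℝ)) •
        permDF i.cycleRange.symm j.cycleRange.symm (metricTensor (toDF F)) := by
  funext x y
  simp only [toDF, metricMul_apply, Finset.sum_apply, Pi.smul_apply, permDF, metricTensor,
    smul_eq_mul, mul_assoc]
  refine Finset.sum_congr rfl fun i _ => Finset.sum_congr rfl fun j _ => ?_
  congr 3
  · simp
  have hx (r : ℕ) (z : Fin (r + 1) → V n) (k : Fin (r + 1)) :
      (z ∘ k.cycleRange.symm) ∘ Fin.succ = z ∘ k.succAbove := by
    funext a; simp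
  rw [hx, hx]

theorem altSum_tensor_toDF_metricMul {n p q r s : ℕ} (α : DF n r s) (F : AltForm n p q) :
    altSum n (r + (p + 1)) (s + (q + 1)) (tensor α (toDF (metricMul n p q F))) =
      ((p + 1) * (q + 1) : ℝ) •
        altSum n (r + (p + 1)) (s + (q + 1)) (tensor α (metricTensor (toDF F))) := by
  have h : tensor α (toDF (metricMul n p q F)) = ∑ i : Fin (p + 1), ∑ j : Fin (q + 1),
      (((-1) ^ (i : ℕ) * (-1) ^ (j : ℕ) : ℝ)) •
        tensor α (permDF i.cycleRange.symm j.cycleRange.symm (metricTensor (toDF F))) := by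
    rw [toDF_metricMul]
    funext x y
    simp [tensor, Finset.mul_sum, mul_left_comm]
  have h1 (i j : ℕ) : ((-1) ^ i * (-1) ^ j * ((-1) ^ i * (-1) ^ j) : ℝ) = 1 := by
    rw [mul_mul_mul_comm, ← mul_pow, ← mul_pow]
    simp
  simp only [h, map_sum, map_smul, altSum_tensor_permDF_right, smul_smul,
    Equiv.Perm.sign_symm, Fin.sign_cycleRange]
  simp [h1, ← Nat.cast_smul_eq_nsmul ℝ, smul_smul]

theorem tensor_smul_left {n p q r s : ℕ} (c : ℝ) (ω : DF n p q) (η : DF n r s) :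
    tensor (c • ω) η = c • tensor ω η := by
  funext x y
  simp [tensor, mul_assoc]

theorem mul_toDF_metricMul_eq_zero {n p q r s : ℕ} (α : DF n r s) (F : AltForm n p q)
    (h : mul (mul α (gm n)) (toDF F) = 0) : mul α (toDF (metricMul n p q F)) = 0 := by
  rw [mul_eq_zero_iff_altSum] at h ⊢
  rw [mul_eq_smul_altSum, tensor_smul_left, map_smul, altSum_tensor_altSum_left, smul_smul,
    smul_eq_zero_iff_right (by simp [Nat.factorial_ne_zero])] at h
  rw [altSum_tensor_toDF_metricMul]
  refine smul_eq_zero_of_right _ ?_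
  funext x y
  rw [← altSum_reindex (finCongr (by omega)) (finCongr (by omega)) _
    (tensor (tensor α (gm n)) (toDF F)), h]
  · rfl
  intro x y
  simp only [tensor, metricTensor, gm, mul_assoc]
  congr 2
  congr 1 <;> funext i
  · exact congrArg x (Fin.ext (by simp; omega))
  · exact congrArg y (Fin.ext (by simp; omega))

theorem eq_zero_of_one_mul_toDF {n p q : ℕ} (F : AltForm n p q)
    (h : mul (gpow n 0) (toDF F) = 0) : F = 0 := by
  rw [mul_eq_zero_iff_altSum] at h
  have h0 : altSum n p q (toDF F) = 0 := by
    funext x y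
    rw [← altSum_reindex (finCongr (by omega)) (finCongr (by omega)) _
      (tensor (gpow n 0) (toDF F)), h]
    · rfl
    intro x y
    simp only [tensor, gpow, one_mul]
    congr 1 <;> funext i <;> simp
  rw [altSum_toDF, smul_eq_zero_iff_right (by simp [Nat.factorial_ne_zero])] at h0
  ext x y
  exact congrFun (congrFun h0 x) y

theorem metricMulTotal_pow_single_eq_zero {n p q l : ℕ} (F : AltForm n p q)
    (h : mul (gpow n l) (toDF F) = 0) : (metricMulTotal n ^ l) (single F) = 0 := by
  induction l generalizing p q with
  | zero => simp [eq_zero_of_one_mul_toDF F h, single]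
  | succ l ih =>
    rw [pow_succ, Module.End.mul_apply, metricMulTotal_single]
    exact ih _ (mul_toDF_metricMul_eq_zero _ F h)

/-- for `p + q + l ≤ n`, multiplication by `g^l` is injective on `D^{p,q}`. -/
theorem gpow_mul_injective (n p q l : ℕ) (h : p + q + l ≤ n)
    (ω : DF n p q) (hω : IsDF ω) (h0 : mul (gpow n l) ω = 0) : ω = 0 := by
  obtain ⟨F, hF⟩ := hω
  obtain rfl : ω = toDF F := funext fun x => funext fun y => hF x y
  rw [eq_zero_of_metricMulTotal_pow_single h F (metricMulTotal_pow_single_eq_zero F h0)]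
  rfl

end DoubleForm
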